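/- Lemma 4.5. Let L > 1 and M = 4L. For the kernel Ḡ defined in the context, there exists a constant C = C(L) > 0 such that for all y > M/2 and all x ≥ y, the y-derivative of Ḡ(y, x − y) (with x fixed), which equals 2·e^{−(x²+y²)}·∑_{j=0}^∞ x^{2j+2}·y^{2j+1}/(j!·(j+1)!), satisfies 2·e^{−(x²+y²)}·∑_{j=0}^∞ x^{2j+2}·y^{2j+1}/(j!·(j+1)!) ≥ C·Ḡ(y, x − y). -/

import Mathlib

/-- `Ḡ(y, x - y)` for `y ≥ 0` in the cover-time problem, written as a function of `y`
and `s = x - y`: it equals `1` if `x = s + y ≤ 0` and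
`e^{-(x² + y²)} ∑ₖ (x^{2k}/k!) ∑_{j ≥ k} y^{2j}/j!` if `x > 0`. -/
noncomputable def Gker0 (y s : ℝ) : ℝ :=
  if s + y ≤ 0 then 1 else
    Real.exp (-((s + y) ^ 2 + y ^ 2)) *
      ∑' k : ℕ, ((s + y) ^ (2 * k) / (Nat.factorial k : ℝ)) *
        ∑' j : ℕ, (if k ≤ j then y ^ (2 * j) / (Nat.factorial j : ℝ) else 0)

/-- The cover-time kernel `Ḡ(y, s)` of Aldous's recursion, with `Ḡ(y, s) = Ḡ(0, s)` for
`y < 0`. -/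
noncomputable def Gker (y s : ℝ) : ℝ := if 0 ≤ y then Gker0 y s else Gker0 0 s

/-- The exponential series as a `HasSum` over the reals. -/
theorem Real.hasSum_pow_div_factorial (t : ℝ) :
    HasSum (fun j : ℕ => t ^ j / (j.factorial : ℝ)) (Real.exp t) := by
  rw [Real.exp_eq_exp_ℝ]
  exact NormedSpace.expSeries_div_hasSum_exp t

/-- First moment of the (unnormalized) Poisson weights. -/
theorem hasSum_mul_pow_div_factorial (t : ℝ) :
    HasSum (fun j : ℕ => (j : ℝ) * (t ^ j / (j.factorial : ℝ))) (t * Real.exp t) := by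
  rw [← hasSum_nat_add_iff' 1]
  simp only [Finset.range_one, Finset.sum_singleton, Nat.cast_zero, zero_mul, sub_zero]
  refine ((Real.hasSum_pow_div_factorial t).mul_left t).congr_fun fun j => ?_
  rw [Nat.factorial_succ]
  push_cast
  field_simp
  ring

/-- Second factorial moment of the (unnormalized) Poisson weights. -/
theorem hasSum_mul_pred_mul_pow_div_factorial (t : ℝ) :
    HasSum (fun j : ℕ => (j : ℝ) * (j - 1) * (t ^ j / (j.factorial : ℝ)))
      (t ^ 2 * Real.exp t) := by
  rw [← hasSum_nat_add_iff' 1]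
  simp only [Finset.range_one, Finset.sum_singleton, Nat.cast_zero, zero_mul, sub_zero]
  have h := (hasSum_mul_pow_div_factorial t).mul_left t
  rw [← mul_assoc, ← sq] at h
  refine h.congr_fun fun j => ?_
  rw [Nat.factorial_succ]
  push_cast
  field_simp
  ring

/-- The variance of a Poisson variable, for the unnormalized weights. -/
theorem hasSum_sub_sq_mul_pow_div_factorial (t : ℝ) :
    HasSum (fun j : ℕ => ((j : ℝ) - t) ^ 2 * (t ^ j / (j.factorial : ℝ)))
      (t * Real.exp t) := by
  have h := ((hasSum_mul_pred_mul_pow_div_factorial t).add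
    ((hasSum_mul_pow_div_factorial t).mul_left (1 - 2 * t))).add
    ((Real.hasSum_pow_div_factorial t).mul_left (t ^ 2))
  convert h using 1
  · ext j; ring
  · ring

/-- Chebyshev's inequality: the Poisson weights with parameter `s ^ 2` within `2 * s` of the mean
carry at least three quarters of the total mass. -/
theorem three_quarters_exp_le_sum_window {s : ℝ} (hs : 0 < s) :
    3 / 4 * Real.exp (s ^ 2) ≤
      ∑ j ∈ Finset.Icc ⌈s ^ 2 - 2 * s⌉₊ ⌊s ^ 2 + 2 * s⌋₊,
        (s ^ 2) ^ j / (j.factorial : ℝ) := by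
  set S := Finset.Icc ⌈s ^ 2 - 2 * s⌉₊ ⌊s ^ 2 + 2 * s⌋₊
  have h1 := (Real.hasSum_pow_div_factorial (s ^ 2)).sub
    ((hasSum_sub_sq_mul_pow_div_factorial (s ^ 2)).mul_left (1 / (4 * s ^ 2)))
  have h2 : HasSum (fun j : ℕ => if j ∈ S then (s ^ 2) ^ j / (j.factorial : ℝ) else 0)
      (∑ j ∈ S, if j ∈ S then (s ^ 2) ^ j / (j.factorial : ℝ) else 0) :=
    hasSum_sum_of_ne_finset_zero fun j hj => if_neg hj
  rw [Finset.sum_congr rfl fun j hj => if_pos hj] at h2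
  have h3 : Real.exp (s ^ 2) - 1 / (4 * s ^ 2) * (s ^ 2 * Real.exp (s ^ 2)) =
      3 / 4 * Real.exp (s ^ 2) := by
    field_simp
    ring
  rw [h3] at h1
  refine hasSum_le (fun j => ?_) h1 h2
  have hq : 0 ≤ (s ^ 2) ^ j / (j.factorial : ℝ) := by positivity
  split_ifs with hj
  · have : 0 ≤ 1 / (4 * s ^ 2) * (((j : ℝ) - s ^ 2) ^ 2 * ((s ^ 2) ^ j / (j.factorial : ℝ))) := by
      positivity
    linarith
  · have hfar : 4 * s ^ 2 ≤ ((j : ℝ) - s ^ 2) ^ 2 := by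
      rw [Finset.mem_Icc, not_and_or, Nat.ceil_le, Nat.le_floor_iff (by positivity), not_le,
        not_le] at hj
      rcases hj with hj | hj <;> nlinarith
    have : 1 ≤ 1 / (4 * s ^ 2) * ((j : ℝ) - s ^ 2) ^ 2 := by
      rw [one_div_mul_eq_div, one_le_div (by positivity)]
      exact hfar
    nlinarith [mul_le_mul_of_nonneg_right this hq]

/-- The window of radius `2 * s` around `s ^ 2` contains at most `4 * s + 1` integers. -/
theorem card_Icc_ceil_floor_le {s : ℝ} (hs : 2 ≤ s) :
    ((Finset.Icc ⌈s ^ 2 - 2 * s⌉₊ ⌊s ^ 2 + 2 * s⌋₊).card : ℝ) ≤ 4 * s + 1 := by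
  have h1 := Nat.le_ceil (s ^ 2 - 2 * s)
  have h2 := Nat.floor_le (show 0 ≤ s ^ 2 + 2 * s by positivity)
  have h3 : ⌈s ^ 2 - 2 * s⌉₊ ≤ ⌊s ^ 2 + 2 * s⌋₊ + 1 := by
    rw [Nat.ceil_le]
    push_cast
    linarith [Nat.lt_floor_add_one (s ^ 2 + 2 * s)]
  rw [Nat.card_Icc, Nat.cast_sub h3]
  push_cast
  linarith

theorem summable_pow_div_factorial_mul_succ {t : ℝ} (ht : 0 ≤ t) :
    Summable fun j : ℕ =>
      t ^ j / (j.factorial : ℝ) * (t ^ (j + 1) / ((j + 1).factorial : ℝ)) := by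
  have hs := (Real.hasSum_pow_div_factorial t).summable
  refine Summable.of_nonneg_of_le (fun j => by positivity) (fun j => ?_)
    (hs.mul_right (Real.exp t))
  gcongr
  exact Real.pow_div_factorial_le_exp t ht (j + 1)

/-- Lower bound for the modified Bessel function `I₁(2 s²)`, from Cauchy–Schwarz on the window
where the Poisson weights concentrate. -/
theorem exp_sq_le_tsum_pow_div_factorial_mul_succ {s : ℝ} (hs : 2 ≤ s) :
    Real.exp (s ^ 2) ^ 2 ≤ 4 * (4 * s + 1) * ∑' j : ℕ,
      (s ^ 2) ^ j / (j.factorial : ℝ) * ((s ^ 2) ^ (j + 1) / ((j + 1).factorial : ℝ)) := by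
  have hwin := three_quarters_exp_le_sum_window (show 0 < s by linarith)
  have hcard := card_Icc_ceil_floor_le hs
  set S := Finset.Icc ⌈s ^ 2 - 2 * s⌉₊ ⌊s ^ 2 + 2 * s⌋₊
  have hCS := sq_sum_le_card_mul_sum_sq (s := S)
    (f := fun j : ℕ => (s ^ 2) ^ j / (j.factorial : ℝ))
  have hterm : ∑ j ∈ S, 4 / 9 * ((s ^ 2) ^ j / (j.factorial : ℝ)) ^ 2 ≤ ∑ j ∈ S,
      (s ^ 2) ^ j / (j.factorial : ℝ) * ((s ^ 2) ^ (j + 1) / ((j + 1).factorial : ℝ)) := by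
    refine Finset.sum_le_sum fun j hj => ?_
    have hj' : (j : ℝ) ≤ s ^ 2 + 2 * s :=
      (Nat.le_floor_iff (by positivity)).1 (Finset.mem_Icc.1 hj).2
    have hratio : 4 / 9 ≤ s ^ 2 / ((j : ℝ) + 1) := by
      rw [div_le_div_iff₀ (by norm_num) (by positivity)]
      nlinarith
    calc 4 / 9 * ((s ^ 2) ^ j / (j.factorial : ℝ)) ^ 2
        ≤ s ^ 2 / ((j : ℝ) + 1) * ((s ^ 2) ^ j / (j.factorial : ℝ)) ^ 2 := by gcongr
      _ = _ := by
        rw [Nat.factorial_succ]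
        push_cast
        field_simp
        ring
  rw [← Finset.mul_sum] at hterm
  have htsum := (summable_pow_div_factorial_mul_succ (sq_nonneg s)).sum_le_tsum S
    fun j _ => by positivity
  have hsq := pow_le_pow_left₀ (by positivity) hwin 2
  have hcard' := mul_le_mul_of_nonneg_right hcard
    (Finset.sum_nonneg fun j (_ : j ∈ S) => sq_nonneg ((s ^ 2) ^ j / (j.factorial : ℝ)))
  have hfin := mul_le_mul_of_nonneg_left (hterm.trans htsum) (show 0 ≤ 4 * s + 1 by linarith)
  linarith

/-- Replacing `x ^ (2 * k) * y ^ (2 * j)` by `(x * y) ^ (k + j)` for `k ≤ j` bounds the kernel. -/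
theorem Gker_sub_le {x y : ℝ} (hy : 0 < y) (hyx : y ≤ x) :
    Gker y (x - y) ≤ Real.exp (-(x ^ 2 + y ^ 2)) * Real.exp (x * y) ^ 2 := by
  have hx : 0 < x := hy.trans_le hyx
  rw [Gker, if_pos hy.le, Gker0, sub_add_cancel, if_neg hx.not_ge]
  gcongr
  have hexp := Real.hasSum_pow_div_factorial (x * y)
  have hle (k : ℕ) : x ^ (2 * k) / (k.factorial : ℝ) *
      (∑' j : ℕ, if k ≤ j then y ^ (2 * j) / (j.factorial : ℝ) else 0) ≤
      (x * y) ^ k / (k.factorial : ℝ) * Real.exp (x * y) := by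
    rw [← tsum_mul_left, ← hexp.tsum_eq, ← tsum_mul_left]
    have hterm (j : ℕ) : x ^ (2 * k) / (k.factorial : ℝ) *
        (if k ≤ j then y ^ (2 * j) / (j.factorial : ℝ) else 0) ≤
        (x * y) ^ k / (k.factorial : ℝ) * ((x * y) ^ j / (j.factorial : ℝ)) := by
      split_ifs with hkj
      · obtain ⟨d, rfl⟩ := Nat.exists_eq_add_of_le hkj
        rw [div_mul_div_comm, div_mul_div_comm]
        refine div_le_div_of_nonneg_right ?_ (by positivity)
        calc x ^ (2 * k) * y ^ (2 * (k + d)) = (x * y) ^ (2 * k) * (y ^ d * y ^ d) := by ring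
          _ ≤ (x * y) ^ (2 * k) * (x ^ d * y ^ d) := by gcongr
          _ = (x * y) ^ k * (x * y) ^ (k + d) := by ring
      · rw [mul_zero]
        positivity
    have hsum := hexp.summable.mul_left ((x * y) ^ k / (k.factorial : ℝ))
    refine Summable.tsum_le_tsum hterm (.of_nonneg_of_le (fun j => ?_) hterm hsum) hsum
    split_ifs <;> positivity
  have hsum := hexp.summable.mul_right (Real.exp (x * y))
  calc _ ≤ ∑' k : ℕ, (x * y) ^ k / (k.factorial : ℝ) * Real.exp (x * y) := by
        refine Summable.tsum_le_tsum hle (.of_nonneg_of_le (fun k => ?_) hle hsum) hsum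
        refine mul_nonneg (by positivity) (tsum_nonneg fun j => ?_)
        split_ifs <;> positivity
    _ = Real.exp (x * y) ^ 2 := by rw [tsum_mul_right, hexp.tsum_eq, sq]

/-- Lemma 4.5: for `L > 1` and `M = 4L`, there is `C = C(L) > 0` such that for all
`y > M/2` and `x ≥ y`, the `y`-derivative of `Ḡ(y, x-y)` (with `x` fixed), which
equals `2 e^{-(x²+y²)} ∑ⱼ x^{2j+2} y^{2j+1}/(j!(j+1)!)`, is at least `C Ḡ(y, x-y)`. -/
theorem cover_kernel_derivative_lower_bound (L : ℝ) (hL : 1 < L) :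
    ∃ C : ℝ, 0 < C ∧ ∀ x y : ℝ, 4 * L / 2 < y → y ≤ x →
      C * Gker y (x - y) ≤
        2 * Real.exp (-(x ^ 2 + y ^ 2)) *
          ∑' j : ℕ, x ^ (2 * j + 2) * y ^ (2 * j + 1) /
            ((Nat.factorial j : ℝ) * (Nat.factorial (j + 1) : ℝ)) := by
  refine ⟨1 / 9, by norm_num, fun x y hLy hyx => ?_⟩
  have hy : 2 < y := by linarith
  have hxy : 0 < x * y := by nlinarith
  have hs2 : 2 ≤ √(x * y) := Real.le_sqrt_of_sq_le (by nlinarith)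
  have hsx : √(x * y) ≤ x := Real.sqrt_le_iff.2 ⟨by linarith, by nlinarith⟩
  have hbessel := exp_sq_le_tsum_pow_div_factorial_mul_succ hs2
  have hG := Gker_sub_le (by linarith) hyx
  rw [Real.sq_sqrt hxy.le] at hbessel
  have hsum : ∑' j : ℕ, x ^ (2 * j + 2) * y ^ (2 * j + 1) /
      ((Nat.factorial j : ℝ) * (Nat.factorial (j + 1) : ℝ)) = x * ∑' j : ℕ,
      (x * y) ^ j / (j.factorial : ℝ) * ((x * y) ^ (j + 1) / ((j + 1).factorial : ℝ)) := by
    rw [← tsum_mul_left]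
    refine tsum_congr fun j => ?_
    rw [div_mul_div_comm, ← mul_div_assoc]
    congr 1
    ring
  rw [hsum]
  set T := ∑' j : ℕ,
    (x * y) ^ j / (j.factorial : ℝ) * ((x * y) ^ (j + 1) / ((j + 1).factorial : ℝ))
  have hT : 0 ≤ T := tsum_nonneg fun j => by positivity
  have hmain : Real.exp (x * y) ^ 2 ≤ 18 * (x * T) := by
    nlinarith [mul_le_mul_of_nonneg_right (show 4 * (4 * √(x * y) + 1) ≤ 18 * x by linarith) hT]
  have := mul_le_mul_of_nonneg_left hmain (Real.exp_pos (-(x ^ 2 + y ^ 2))).le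
  linarith
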